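/- Under assumptions (A2)–(A8), the optimal shifted costs satisfy the lower estimate v_f(x) + v_b(z) ≤ liminf_{T→+∞} C_T(û_T,x,z), where C_T(û_T,x,z) := ∫₀ᵀ w(ŷ_T(t),û_T(t)) dt = v(T,x,z) − T·v̄ is the shifted optimal cost of the finite-horizon problem. -/

import Mathlib

open MeasureTheory Filter Topology Metric Set

noncomputable section

/-- Euclidean state/control spaces. -/
abbrev Euc (n : ℕ) := EuclideanSpace ℝ (Fin n)

/-- An admissible pair `(y,u)` on `[0,T]` for the dynamics `f` with control constraint set `Ω`:
`u` is measurable, `Ω`-valued a.e. on `[0,T]`, and `y t = y 0 + ∫₀ᵗ f (y s) (u s) ds` on `[0,T]`. -/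
def IsAdmissible {n p : ℕ} (f : Euc n → Euc p → Euc n) (Ω : Set (Euc p)) (T : ℝ)
    (y : ℝ → Euc n) (u : ℝ → Euc p) : Prop :=
  Measurable u ∧ (∀ᵐ t ∂(volume.restrict (Icc (0:ℝ) T)), u t ∈ Ω) ∧
  ∀ t ∈ Icc (0:ℝ) T, y t = y 0 + ∫ s in (0:ℝ)..t, f (y s) (u s)

/-- An admissible pair `(y,u)` on `[0,∞)` for the dynamics `f`. -/
def IsAdmissibleInf {n p : ℕ} (f : Euc n → Euc p → Euc n) (Ω : Set (Euc p))
    (y : ℝ → Euc n) (u : ℝ → Euc p) : Prop :=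
  Measurable u ∧ (∀ᵐ t ∂(volume.restrict (Ici (0:ℝ))), u t ∈ Ω) ∧
  ∀ t, 0 ≤ t → y t = y 0 + ∫ s in (0:ℝ)..t, f (y s) (u s)

/-- A class-K function: continuous, (strictly) increasing on `[0,∞)`, nonnegative, vanishing at `0`. -/
def IsClassK (α : ℝ → ℝ) : Prop :=
  ContinuousOn α (Ici 0) ∧ StrictMonoOn α (Ici 0) ∧ α 0 = 0 ∧ ∀ s ∈ Ici (0:ℝ), 0 ≤ α s

/-- Strict dissipativity at `(ȳ,ū)` with supply rate `w`, (bounded) storage function `S` and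
class-K function `α`. -/
def StrictlyDissipative {n p : ℕ} (f : Euc n → Euc p → Euc n) (Ω : Set (Euc p))
    (w : Euc n → Euc p → ℝ) (ybar : Euc n) (ubar : Euc p)
    (S : Euc n → ℝ) (α : ℝ → ℝ) : Prop :=
  (∃ M, ∀ x, |S x| ≤ M) ∧ IsClassK α ∧
  ∀ T > (0:ℝ), ∀ y u, IsAdmissible f Ω T y u →
    S (y T) + ∫ t in (0:ℝ)..T, α ‖(y t - ybar, u t - ubar)‖ ≤
      S (y 0) + ∫ t in (0:ℝ)..T, w (y t) (u t)

/-- The value function `v(T,x,z)` of the finite-horizon problem. -/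
def valueFn {n p : ℕ} (f : Euc n → Euc p → Euc n) (f0 : Euc n → Euc p → ℝ)
    (Ω : Set (Euc p)) (T : ℝ) (x z : Euc n) : ℝ :=
  sInf {c | ∃ y u, IsAdmissible f Ω T y u ∧ y 0 = x ∧ y T = z ∧
    c = ∫ t in (0:ℝ)..T, f0 (y t) (u t)}

/-- The value of the shifted infinite-horizon problem with dynamics `f`, running cost `w`
and initial state `x` (the cost of an admissible pair is the limit of its partial costs). -/
def vInf {n p : ℕ} (f : Euc n → Euc p → Euc n) (Ω : Set (Euc p))
    (w : Euc n → Euc p → ℝ) (x : Euc n) : ℝ :=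
  sInf {c | ∃ y u, IsAdmissibleInf f Ω y u ∧ y 0 = x ∧
    Tendsto (fun T => ∫ t in (0:ℝ)..T, w (y t) (u t)) atTop (𝓝 c)}

/-- Times at which `ybar` can be reached from `x` by an admissible pair for `f`. -/
def reachTimes {n p : ℕ} (f : Euc n → Euc p → Euc n) (Ω : Set (Euc p))
    (x ybar : Euc n) : Set ℝ :=
  {t | 0 ≤ t ∧ ∃ y u, IsAdmissible f Ω t y u ∧ y 0 = x ∧ y t = ybar}

/-- The minimum time to reach `ybar` from `x` with the dynamics `f`. -/
def minTime {n p : ℕ} (f : Euc n → Euc p → Euc n) (Ω : Set (Euc p))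
    (x ybar : Euc n) : ℝ :=
  sInf (reachTimes f Ω x ybar)

variable {n p : ℕ}

/-- An admissible pair on `[0,L]` whose trajectory is continuous. -/
structure IsTraj (g : Euc n → Euc p → Euc n) (Ω : Set (Euc p)) (L : ℝ)
    (y : ℝ → Euc n) (u : ℝ → Euc p) : Prop where
  nonneg : 0 ≤ L
  adm : IsAdmissible g Ω L y u
  cont : ContinuousOn y (Icc 0 L)

/-- A function bounded along a measurable bounded trajectory with controls in a compact set. -/
lemma integrableOn_along {F : Type*} [NormedAddCommGroup F] {Ω : Set (Euc p)}
    (hΩ : IsCompact Ω) {h : Euc n → Euc p → F} (hh : Continuous (Function.uncurry h)) {L : ℝ}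
    {y : ℝ → Euc n} {u : ℝ → Euc p}
    (hy : AEStronglyMeasurable y (volume.restrict (Icc 0 L)))
    (hu : Measurable u) (huΩ : ∀ᵐ t ∂(volume.restrict (Icc (0:ℝ) L)), u t ∈ Ω) {b : ℝ}
    (hb : ∀ t ∈ Icc 0 L, ‖y t‖ ≤ b) :
    IntegrableOn (fun t => h (y t) (u t)) (Icc 0 L) := by
  obtain ⟨C, hC⟩ := ((isCompact_closedBall (0 : Euc n) b).prod hΩ).exists_bound_of_continuousOn
    hh.continuousOn
  refine ⟨?_, HasFiniteIntegral.restrict_of_bounded (C := C) (by simp) ?_⟩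
  · exact hh.comp_aestronglyMeasurable (hy.prodMk hu.aestronglyMeasurable)
  · filter_upwards [huΩ, ae_restrict_mem measurableSet_Icc] with t ht ht'
    exact hC (y t, u t) ⟨by simpa using hb t ht', ht⟩

lemma IsTraj.exists_bound {g : Euc n → Euc p → Euc n} {Ω : Set (Euc p)} {L : ℝ}
    {y : ℝ → Euc n} {u : ℝ → Euc p} (h : IsTraj g Ω L y u) :
    ∃ b, ∀ t ∈ Icc 0 L, ‖y t‖ ≤ b :=
  isCompact_Icc.exists_bound_of_continuousOn h.cont

lemma IsTraj.integrableOn {F : Type*} [NormedAddCommGroup F]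
    {g : Euc n → Euc p → Euc n} {Ω : Set (Euc p)} {L : ℝ}
    {y : ℝ → Euc n} {u : ℝ → Euc p} (ht : IsTraj g Ω L y u)
    (hΩ : IsCompact Ω) {h : Euc n → Euc p → F} (hh : Continuous (Function.uncurry h)) :
    IntegrableOn (fun t => h (y t) (u t)) (Icc 0 L) := by
  obtain ⟨b, hb⟩ := ht.exists_bound
  exact integrableOn_along hΩ hh (ht.cont.aestronglyMeasurable measurableSet_Icc)
    ht.adm.1 ht.adm.2.1 hb

lemma IsTraj.intervalIntegrable {F : Type*} [NormedAddCommGroup F]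
    {g : Euc n → Euc p → Euc n} {Ω : Set (Euc p)} {L : ℝ}
    {y : ℝ → Euc n} {u : ℝ → Euc p} (ht : IsTraj g Ω L y u)
    (hΩ : IsCompact Ω) {h : Euc n → Euc p → F} (hh : Continuous (Function.uncurry h))
    {s t : ℝ} (hs : s ∈ Icc 0 L) (ht' : t ∈ Icc 0 L) :
    IntervalIntegrable (fun t => h (y t) (u t)) volume s t :=
  ((ht.integrableOn hΩ hh).mono_set (uIcc_subset_Icc hs ht')).intervalIntegrable

/-- A bounded admissible trajectory is continuous. -/
lemma IsAdmissible.isTraj {g : Euc n → Euc p → Euc n} (hg : Continuous (Function.uncurry g))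
    {Ω : Set (Euc p)} (hΩ : IsCompact Ω) {L : ℝ} (hL : 0 ≤ L) {y : ℝ → Euc n} {u : ℝ → Euc p}
    (h : IsAdmissible g Ω L y u) {b : ℝ} (hb : ∀ t ∈ Icc 0 L, ‖y t‖ ≤ b) :
    IsTraj g Ω L y u := by
  refine ⟨hL, h, ?_⟩
  obtain ⟨hu, huΩ, hy⟩ := h
  set φ : ℝ → Euc n := fun s => g (y s) (u s) with hφ
  have key : ∀ T ∈ Icc 0 L, IntegrableOn φ (Icc 0 T) → ContinuousOn y (Icc 0 T) := by
    intro T hT hint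
    have h1 : ContinuousOn (fun t => y 0 + ∫ s in (0:ℝ)..t, φ s) (Icc 0 T) := by
      have := intervalIntegral.continuousOn_primitive_interval (a := 0) (b := T) (μ := volume)
        (f := φ) (by rwa [uIcc_of_le hT.1])
      rw [uIcc_of_le hT.1] at this
      exact continuousOn_const.add this
    exact h1.congr fun t ht => hy t ⟨ht.1, ht.2.trans hT.2⟩
  set A : Set ℝ := {t | t ∈ Icc 0 L ∧ IntegrableOn φ (Icc 0 t)} with hA
  have hA0 : (0:ℝ) ∈ A := ⟨⟨le_rfl, hL⟩, by simp⟩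
  have hAb : BddAbove A := ⟨L, fun t ht => ht.1.2⟩
  set τ := sSup A with hτ
  have hτ0 : 0 ≤ τ := le_csSup hAb hA0
  have hleft : ContinuousOn y (Ico 0 τ) := by
    intro t ht
    obtain ⟨t', ht', htt'⟩ := exists_lt_of_lt_csSup ⟨0, hA0⟩ ht.2
    have := key t' ht'.1 ht'.2 t ⟨ht.1, htt'.le⟩
    refine this.mono_of_mem_nhdsWithin ?_
    filter_upwards [self_mem_nhdsWithin, mem_nhdsWithin_of_mem_nhds (Iio_mem_nhds htt')]
      with s hs hs'
    exact ⟨hs.1, le_of_lt hs'⟩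
  have hright : ∀ t ∈ Ioc τ L, y t = y 0 := by
    intro t ht
    have htL : t ∈ Icc 0 L := ⟨hτ0.trans ht.1.le, ht.2⟩
    have hni : ¬ IntervalIntegrable φ volume 0 t := by
      rw [intervalIntegrable_iff_integrableOn_Icc_of_le htL.1]
      intro hc
      exact absurd (le_csSup hAb (show t ∈ A from ⟨htL, hc⟩)) (not_le.2 ht.1)
    rw [hy t htL, intervalIntegral.integral_undef hni, add_zero]
  have hm1 : AEStronglyMeasurable y (volume.restrict (Ico 0 τ)) :=
    hleft.aestronglyMeasurable measurableSet_Ico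
  have hm2 : AEStronglyMeasurable y (volume.restrict (Ioc τ L)) :=
    (continuousOn_const.congr hright).aestronglyMeasurable measurableSet_Ioc
  have hm3 : AEStronglyMeasurable y (volume.restrict {τ}) := by
    simp
  have hm : AEStronglyMeasurable y (volume.restrict (Icc 0 L)) := by
    refine (aestronglyMeasurable_union_iff.2
      ⟨aestronglyMeasurable_union_iff.2 ⟨hm1, hm3⟩, hm2⟩).mono_set ?_
    intro t ht
    rcases lt_trichotomy t τ with h | h | h
    · exact Or.inl (Or.inl ⟨ht.1, h⟩)
    · exact Or.inl (Or.inr h)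
    · exact Or.inr ⟨h, ht.2⟩
  exact key L ⟨hL, le_rfl⟩ (integrableOn_along hΩ hg hm hu huΩ hb)

lemma IsTraj.restrict {g : Euc n → Euc p → Euc n} {Ω : Set (Euc p)} {L : ℝ}
    {y : ℝ → Euc n} {u : ℝ → Euc p} (h : IsTraj g Ω L y u) {t : ℝ} (ht : t ∈ Icc 0 L) :
    IsTraj g Ω t y u := by
  have hsub : Icc 0 t ⊆ Icc 0 L := Icc_subset_Icc_right ht.2
  exact ⟨ht.1, ⟨h.adm.1, ae_restrict_of_ae_restrict_of_subset hsub h.adm.2.1,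
    fun s hs => h.adm.2.2 s (hsub hs)⟩, h.cont.mono hsub⟩

lemma IsTraj.congr {g : Euc n → Euc p → Euc n} {Ω : Set (Euc p)} {L : ℝ}
    {y y' : ℝ → Euc n} {u u' : ℝ → Euc p} (h : IsTraj g Ω L y u) (hu' : Measurable u')
    (hy : ∀ t ∈ Icc 0 L, y' t = y t) (hu : ∀ t ∈ Icc 0 L, u' t = u t) :
    IsTraj g Ω L y' u' := by
  refine ⟨h.nonneg, ⟨hu', ?_, ?_⟩, h.cont.congr hy⟩
  · filter_upwards [h.adm.2.1, ae_restrict_mem measurableSet_Icc] with t ht ht'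
    rwa [hu t ht']
  · intro t ht
    rw [hy t ht, hy 0 ⟨le_rfl, h.nonneg⟩, h.adm.2.2 t ht]
    congr 1
    refine intervalIntegral.integral_congr fun s hs => ?_
    rw [uIcc_of_le ht.1] at hs
    have hs' : s ∈ Icc 0 L := ⟨hs.1, hs.2.trans ht.2⟩
    simp only [hy s hs', hu s hs']

/-- Time reversal. -/
lemma IsTraj.reverse {g g' : Euc n → Euc p → Euc n} (hg : Continuous (Function.uncurry g))
    (hgg' : ∀ a b, g' a b = -g a b) {Ω : Set (Euc p)} (hΩ : IsCompact Ω) {L : ℝ}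
    {y : ℝ → Euc n} {u : ℝ → Euc p} (h : IsTraj g Ω L y u) :
    IsTraj g' Ω L (fun t => y (L - t)) (fun t => u (L - t)) := by
  have hmaps : MapsTo (fun t => L - t) (Icc 0 L) (Icc 0 L) := fun t ht =>
    ⟨by linarith [ht.2], by linarith [ht.1]⟩
  refine ⟨h.nonneg, ⟨h.adm.1.comp (measurable_const.sub measurable_id), ?_, ?_⟩,
    h.cont.comp (by fun_prop) hmaps⟩
  · have h1 := (ae_restrict_iff' measurableSet_Icc).1 h.adm.2.1
    have h2 := (Measure.measurePreserving_sub_left volume L).quasiMeasurePreserving.ae h1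
    refine (ae_restrict_iff' measurableSet_Icc).2 ?_
    filter_upwards [h2] with t ht ht' using ht (hmaps ht')
  · intro t ht
    have h0 : (0:ℝ) ∈ Icc 0 L := ⟨le_rfl, h.nonneg⟩
    have hL : L ∈ Icc 0 L := ⟨h.nonneg, le_rfl⟩
    have e1 : ∫ s in (0:ℝ)..t, g' (y (L - s)) (u (L - s)) =
        -∫ s in (L - t)..L, g (y s) (u s) := by
      rw [← intervalIntegral.integral_neg]
      simp only [← hgg']
      rw [intervalIntegral.integral_comp_sub_left (fun s => g' (y s) (u s)) L, sub_zero]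
    simp only []
    rw [e1, sub_zero, h.adm.2.2 _ (hmaps ht), h.adm.2.2 _ hL,
      ← intervalIntegral.integral_add_adjacent_intervals
        (h.intervalIntegrable hΩ hg h0 (hmaps ht)) (h.intervalIntegrable hΩ hg (hmaps ht) hL)]
    abel

/-- The function equal to `φ` up to time `L` and following `ψ`, restarted at time `L`, later. -/
def cat {β : Type*} (L : ℝ) (φ ψ : ℝ → β) : ℝ → β := fun t => if t ≤ L then φ t else ψ (t - L)

lemma cat_of_le {β : Type*} {L : ℝ} (φ ψ : ℝ → β) {t : ℝ} (h : t ≤ L) : cat L φ ψ t = φ t :=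
  if_pos h

lemma cat_add {β : Type*} {L : ℝ} {φ ψ : ℝ → β} (h0 : φ L = ψ 0) {s : ℝ} (hs : 0 ≤ s) :
    cat L φ ψ (L + s) = ψ s := by
  rcases hs.eq_or_lt with rfl | hs
  · simp [cat, h0]
  · simp [cat, not_le.2 hs]

lemma cat_comp {E U F : Type*} (h : E → U → F) (L : ℝ) (y y' : ℝ → E) (u u' : ℝ → U) :
    (fun t => h (cat L y y' t) (cat L u u' t)) =
      cat L (fun t => h (y t) (u t)) (fun t => h (y' t) (u' t)) := by
  funext t
  unfold cat
  split_ifs <;> rfl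

lemma measurable_cat {β : Type*} [MeasurableSpace β] {L : ℝ} {φ ψ : ℝ → β}
    (hφ : Measurable φ) (hψ : Measurable ψ) : Measurable (cat L φ ψ) :=
  Measurable.ite measurableSet_Iic hφ (hψ.comp (measurable_id.sub_const L))

lemma integral_cat_of_le {F : Type*} [NormedAddCommGroup F] [NormedSpace ℝ F] {L s : ℝ}
    (φ ψ : ℝ → F) (hs : 0 ≤ s) (hsL : s ≤ L) :
    ∫ t in (0:ℝ)..s, cat L φ ψ t = ∫ t in (0:ℝ)..s, φ t := by
  refine intervalIntegral.integral_congr fun t ht => ?_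
  rw [uIcc_of_le hs] at ht
  exact cat_of_le _ _ (ht.2.trans hsL)

lemma integral_cat_add {F : Type*} [NormedAddCommGroup F] [NormedSpace ℝ F] {L s : ℝ}
    {φ ψ : ℝ → F} (hL : 0 ≤ L) (hs : 0 ≤ s) (hφ : IntervalIntegrable φ volume 0 L)
    (hψ : IntervalIntegrable ψ volume 0 s) :
    ∫ t in (0:ℝ)..(L + s), cat L φ ψ t = (∫ t in (0:ℝ)..L, φ t) + ∫ t in (0:ℝ)..s, ψ t := by
  have e1 : EqOn φ (cat L φ ψ) (uIoo 0 L) := fun t ht => by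
    rw [uIoo_of_le hL] at ht
    exact (cat_of_le _ _ ht.2.le).symm
  have e2 : EqOn (fun t => ψ (t - L)) (cat L φ ψ) (uIoo L (L + s)) := fun t ht => by
    rw [uIoo_of_le (by linarith)] at ht
    simp [cat, not_le.2 ht.1]
  have hψ' : IntervalIntegrable (fun t => ψ (t - L)) volume L (L + s) := by
    have := hψ.comp_sub_right L
    rwa [zero_add, add_comm s L] at this
  rw [← intervalIntegral.integral_add_adjacent_intervals (hφ.congr_uIoo e1) (hψ'.congr_uIoo e2),
    ← intervalIntegral.integral_congr_uIoo e1, ← intervalIntegral.integral_congr_uIoo e2,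
    intervalIntegral.integral_comp_sub_right]
  simp

/-- Concatenation of trajectories. -/
lemma IsTraj.cat {g : Euc n → Euc p → Euc n} (hg : Continuous (Function.uncurry g))
    {Ω : Set (Euc p)} (hΩ : IsCompact Ω) {L L' : ℝ}
    {y y' : ℝ → Euc n} {u u' : ℝ → Euc p} (h : IsTraj g Ω L y u) (h' : IsTraj g Ω L' y' u')
    (hj : y L = y' 0) : IsTraj g Ω (L + L') (cat L y y') (cat L u u') := by
  have hL := h.nonneg
  have hL' := h'.nonneg
  refine ⟨by linarith, ⟨measurable_cat h.adm.1 h'.adm.1, ?_, ?_⟩, ?_⟩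
  · have h1 := (ae_restrict_iff' measurableSet_Icc).1 h.adm.2.1
    have h2 := (measurePreserving_sub_right volume L).quasiMeasurePreserving.ae
      ((ae_restrict_iff' measurableSet_Icc).1 h'.adm.2.1)
    refine (ae_restrict_iff' measurableSet_Icc).2 ?_
    filter_upwards [h1, h2] with t h1 h2 ht
    unfold _root_.cat
    split_ifs with hc
    · exact h1 ⟨ht.1, hc⟩
    · exact h2 ⟨by linarith [not_le.1 hc], by linarith [ht.2]⟩
  · intro t ht
    have h00 : (0:ℝ) ∈ Icc 0 L := ⟨le_rfl, hL⟩
    rw [cat_of_le y y' hL, cat_comp g]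
    rcases le_total t L with htL | htL
    · rw [cat_of_le _ _ htL, integral_cat_of_le _ _ ht.1 htL]
      exact h.adm.2.2 t ⟨ht.1, htL⟩
    · obtain ⟨s, rfl⟩ : ∃ s, t = L + s := ⟨t - L, by ring⟩
      have hs : s ∈ Icc 0 L' := ⟨by linarith, by linarith [ht.2]⟩
      rw [cat_add hj hs.1, integral_cat_add hL hs.1
        (h.intervalIntegrable hΩ hg h00 ⟨hL, le_rfl⟩)
        (h'.intervalIntegrable hΩ hg ⟨le_rfl, hL'⟩ hs), h'.adm.2.2 s hs, ← hj,
        h.adm.2.2 L ⟨hL, le_rfl⟩]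
      abel
  · have hsplit : Icc 0 (L + L') = Icc 0 L ∪ Icc L (L + L') :=
      (Icc_union_Icc_eq_Icc hL (by linarith)).symm
    rw [hsplit]
    refine ContinuousOn.union_of_isClosed ?_ ?_ isClosed_Icc isClosed_Icc
    · exact h.cont.congr fun t ht => cat_of_le _ _ ht.2
    · have : ContinuousOn (fun t => y' (t - L)) (Icc L (L + L')) :=
        h'.cont.comp (by fun_prop) fun t ht => ⟨by linarith [ht.1], by linarith [ht.2]⟩
      refine this.congr fun t ht => ?_
      have := cat_add hj (s := t - L) (by linarith [ht.1])
      rwa [add_sub_cancel] at this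

lemma IsTraj.const {g : Euc n → Euc p → Euc n} {Ω : Set (Euc p)} {a : Euc n} {v : Euc p}
    (hv : v ∈ Ω) (h : g a v = 0) {L : ℝ} (hL : 0 ≤ L) :
    IsTraj g Ω L (fun _ => a) (fun _ => v) :=
  ⟨hL, ⟨measurable_const, by simp [hv], by simp [h]⟩, continuousOn_const⟩

lemma isAdmissibleInf_of_isTraj {g : Euc n → Euc p → Euc n} {Ω : Set (Euc p)}
    {y : ℝ → Euc n} {u : ℝ → Euc p} (h : ∀ T, 0 ≤ T → IsTraj g Ω T y u) :
    IsAdmissibleInf g Ω y u := by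
  refine ⟨(h 0 le_rfl).adm.1, ?_, fun t ht => (h t ht).adm.2.2 t ⟨ht, le_rfl⟩⟩
  rw [ae_restrict_iff' measurableSet_Ici]
  have : ∀ N : ℕ, ∀ᵐ t ∂(volume : Measure ℝ), t ∈ Icc (0:ℝ) N → u t ∈ Ω := fun N =>
    (ae_restrict_iff' measurableSet_Icc).1 (h N N.cast_nonneg).adm.2.1
  filter_upwards [ae_all_iff.2 this] with t ht ht0
  obtain ⟨N, hN⟩ := exists_nat_ge t
  exact ht N ⟨ht0, hN⟩

/-- Concatenation of a trajectory on `[0,L]` with one on `[0,∞)`, and its cost. -/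
lemma IsTraj.cat_inf {g : Euc n → Euc p → Euc n} (hg : Continuous (Function.uncurry g))
    {Ω : Set (Euc p)} (hΩ : IsCompact Ω) {w : Euc n → Euc p → ℝ}
    (hw : Continuous (Function.uncurry w)) {L : ℝ}
    {y y' : ℝ → Euc n} {u u' : ℝ → Euc p} (h : IsTraj g Ω L y u)
    (h' : ∀ T, 0 ≤ T → IsTraj g Ω T y' u') (hj : y L = y' 0) :
    (∀ T, 0 ≤ T → IsTraj g Ω T (_root_.cat L y y') (_root_.cat L u u')) ∧
    (∀ s, 0 ≤ s → ∫ t in (0:ℝ)..(L + s), w (_root_.cat L y y' t) (_root_.cat L u u' t) =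
      (∫ t in (0:ℝ)..L, w (y t) (u t)) + ∫ t in (0:ℝ)..s, w (y' t) (u' t)) := by
  refine ⟨fun T hT => (h.cat hg hΩ (h' T hT) hj).restrict ⟨hT, by linarith [h.nonneg]⟩,
    fun s hs => ?_⟩
  rw [cat_comp w]
  exact integral_cat_add h.nonneg hs
    (h.intervalIntegrable hΩ hw ⟨le_rfl, h.nonneg⟩ ⟨h.nonneg, le_rfl⟩)
    ((h' s hs).intervalIntegrable hΩ hw ⟨le_rfl, hs⟩ ⟨hs, le_rfl⟩)

lemma tendsto_of_shift {J K : ℝ → ℝ} {L a c : ℝ} (h : ∀ s, 0 ≤ s → J (L + s) = a + K s)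
    (hK : Tendsto K atTop (𝓝 c)) : Tendsto J atTop (𝓝 (a + c)) := by
  have h1 : Tendsto (fun t => a + K (t - L)) atTop (𝓝 (a + c)) :=
    tendsto_const_nhds.add (hK.comp (tendsto_atTop_add_const_right _ (-L) tendsto_id))
  refine h1.congr' ?_
  filter_upwards [eventually_ge_atTop L] with t ht
  rw [← h (t - L) (by linarith), add_sub_cancel]

/-- A trajectory ending at a zero-cost equilibrium extends to `[0,∞)` at no additional cost. -/
lemma IsTraj.exists_extension {g : Euc n → Euc p → Euc n} (hg : Continuous (Function.uncurry g))
    {Ω : Set (Euc p)} (hΩ : IsCompact Ω) {w : Euc n → Euc p → ℝ}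
    (hw : Continuous (Function.uncurry w)) {a : Euc n} {v : Euc p} (hv : v ∈ Ω)
    (hgv : g a v = 0) (hwv : w a v = 0) {L : ℝ} {y : ℝ → Euc n} {u : ℝ → Euc p}
    (h : IsTraj g Ω L y u) (hyL : y L = a) :
    ∃ y' u', IsAdmissibleInf g Ω y' u' ∧ y' 0 = y 0 ∧
      Tendsto (fun T => ∫ t in (0:ℝ)..T, w (y' t) (u' t)) atTop
        (𝓝 (∫ t in (0:ℝ)..L, w (y t) (u t))) := by
  obtain ⟨h1, h2⟩ := h.cat_inf hg hΩ hw (fun T hT => IsTraj.const hv hgv hT) hyL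
  refine ⟨_, _, isAdmissibleInf_of_isTraj h1, cat_of_le _ _ h.nonneg, ?_⟩
  simpa using tendsto_of_shift h2 (c := 0) (by simp [hwv])

/-- Points near `a` can be steered to `a` quickly and at small cost. -/
def SteersNear (g : Euc n → Euc p → Euc n) (Ω : Set (Euc p)) (w : Euc n → Euc p → ℝ)
    (a : Euc n) : Prop :=
  ∀ ε > 0, ∃ δ > 0, ∀ x', ‖x' - a‖ < δ → ∃ L y u, IsTraj g Ω L y u ∧ y 0 = x' ∧ y L = a ∧
    ∀ s ∈ Icc (0:ℝ) L, |∫ t in (0:ℝ)..s, w (y t) (u t)| ≤ ε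

lemma minTime_nonneg (g : Euc n → Euc p → Euc n) (Ω : Set (Euc p)) (x a : Euc n) :
    0 ≤ minTime g Ω x a :=
  Real.sInf_nonneg fun _ ht => ht.1

lemma steersNear_of_minTime {g : Euc n → Euc p → Euc n} (hg : Continuous (Function.uncurry g))
    {Ω : Set (Euc p)} (hΩ : IsCompact Ω) {w : Euc n → Euc p → ℝ}
    (hw : Continuous (Function.uncurry w)) {a : Euc n} {v : Euc p} {r r2 K : ℝ}
    (hr : 0 < r) (hr2 : 0 < r2)
    (h0 : minTime g Ω a a = 0)
    (hcont : ContinuousWithinAt (fun x' => minTime g Ω x' a) (ball a r) a)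
    (hbd : ∀ x' ∈ closedBall a r2, ∃ y' u',
      IsAdmissible g Ω (minTime g Ω x' a) y' u' ∧ y' 0 = x' ∧ y' (minTime g Ω x' a) = a ∧
      ∀ t ∈ Icc (0:ℝ) (minTime g Ω x' a), ‖y' t - a‖ + ‖u' t - v‖ ≤ K) :
    SteersNear g Ω w a := by
  intro ε hε
  obtain ⟨C, hC⟩ := ((isCompact_closedBall a K).prod
    (isCompact_closedBall v K)).exists_bound_of_continuousOn hw.continuousOn
  have hC1 : 0 < |C| + 1 := by positivity
  obtain ⟨δ, hδ, hδ'⟩ := Metric.continuousWithinAt_iff.1 hcont (ε / (|C| + 1)) (by positivity)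
  refine ⟨min δ (min r r2), by positivity, fun x' hx' => ?_⟩
  rw [← dist_eq_norm, lt_min_iff, lt_min_iff] at hx'
  have hτ := hδ' (mem_ball.2 hx'.2.1) hx'.1
  simp only [h0, Real.dist_eq, sub_zero] at hτ
  obtain ⟨y, u, hadm, hy0, hyL, hb⟩ := hbd x' (mem_closedBall.2 hx'.2.2.le)
  set L := minTime g Ω x' a with hLdef
  have hL : 0 ≤ L := minTime_nonneg g Ω x' a
  rw [abs_of_nonneg hL] at hτ
  refine ⟨L, y, u, hadm.isTraj hg hΩ hL (b := K + ‖a‖) fun t ht => ?_, hy0, hyL, fun s hs => ?_⟩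
  · have h1 := hb t ht
    have h2 := norm_le_norm_sub_add (y t) a
    linarith [norm_nonneg (u t - v)]
  · have h1 : ‖∫ t in (0:ℝ)..s, w (y t) (u t)‖ ≤ C * |s - 0| := by
      refine intervalIntegral.norm_integral_le_of_norm_le_const fun t ht => ?_
      rw [uIoc_of_le hs.1] at ht
      have h2 := hb t ⟨ht.1.le, ht.2.trans hs.2⟩
      refine hC (y t, u t) ⟨?_, ?_⟩
      · rw [mem_closedBall, dist_eq_norm]; linarith [norm_nonneg (u t - v)]
      · rw [mem_closedBall, dist_eq_norm]; linarith [norm_nonneg (y t - a)]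
    rw [sub_zero, abs_of_nonneg hs.1, Real.norm_eq_abs] at h1
    rw [lt_div_iff₀ hC1] at hτ
    nlinarith [le_abs_self C, hs.1, hs.2]

lemma continuous_classK {α : ℝ → ℝ} (hα : IsClassK α) (a : Euc n) (v : Euc p) :
    Continuous (Function.uncurry fun (y : Euc n) (u : Euc p) => α ‖(y - a, u - v)‖) := by
  have : Continuous fun q : Euc n × Euc p => ‖(q.1 - a, q.2 - v)‖ := by fun_prop
  exact hα.1.comp_continuous this fun q => norm_nonneg _

/-- If a control other than the equilibrium control is available, there are loops at the
equilibrium of arbitrarily small positive cost. -/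
lemma exists_small_loop {g : Euc n → Euc p → Euc n} (hg : ContDiff ℝ 1 (Function.uncurry g))
    {Ω : Set (Euc p)} (hΩ : IsCompact Ω) {w : Euc n → Euc p → ℝ}
    (hw : Continuous (Function.uncurry w)) {a : Euc n} {v v1 : Euc p} (hv1 : v1 ∈ Ω)
    (hne : v1 ≠ v) (hsteer : SteersNear g Ω w a) {α : ℝ → ℝ} (hα : IsClassK α)
    (hpos : ∀ L y u, 0 < L → IsTraj g Ω L y u → y 0 = a → y L = a →
      ∫ t in (0:ℝ)..L, α ‖(y t - a, u t - v)‖ ≤ ∫ t in (0:ℝ)..L, w (y t) (u t))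
    {ε : ℝ} (hε : 0 < ε) :
    ∃ L y u, IsTraj g Ω L y u ∧ y 0 = a ∧ y L = a ∧ 0 < ∫ t in (0:ℝ)..L, w (y t) (u t) ∧
      ∀ s ∈ Icc (0:ℝ) L, |∫ t in (0:ℝ)..s, w (y t) (u t)| ≤ ε := by
  have hgc := hg.continuous
  have hvf : ContDiffAt ℝ 1 (fun q => g q v1) a :=
    (hg.comp (contDiff_id.prodMk contDiff_const)).contDiffAt
  obtain ⟨β, hβ0, η₀, hη₀, hβ⟩ :=
    hvf.exists_forall_mem_closedBall_exists_eq_forall_mem_Ioo_hasDerivAt₀ 0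
  simp only [zero_sub, zero_add] at hβ
  have hβc : ContinuousOn β (Icc 0 (η₀ / 2)) := fun t ht =>
    (hβ t ⟨by linarith [ht.1], by linarith [ht.2]⟩).continuousAt.continuousWithinAt
  have htraj : ∀ η ∈ Icc 0 (η₀ / 2), IsTraj g Ω η β (fun _ => v1) := by
    intro η hη
    refine ⟨hη.1, ⟨measurable_const, by simp [hv1], fun t ht => ?_⟩,
      hβc.mono (Icc_subset_Icc_right hη.2)⟩
    have hsub : uIcc 0 t ⊆ Icc 0 (η₀ / 2) := by
      rw [uIcc_of_le ht.1]; exact Icc_subset_Icc_right (ht.2.trans hη.2)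
    rw [intervalIntegral.integral_eq_sub_of_hasDerivAt (f := β)]
    · abel
    · intro s hs
      have := hsub hs
      exact hβ s ⟨by linarith [this.1], by linarith [this.2]⟩
    · refine ContinuousOn.intervalIntegrable ?_
      exact hgc.comp_continuousOn ((hβc.mono hsub).prodMk continuousOn_const)
  obtain ⟨C, hC⟩ := isCompact_Icc.exists_bound_of_continuousOn
    (hw.comp_continuousOn (hβc.prodMk (continuousOn_const (c := v1))))
  obtain ⟨δ, hδ, hsteer⟩ := hsteer (ε / 2) (by positivity)
  have hC1 : 0 < |C| + 1 := by positivity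
  obtain ⟨η, hη, hη0, hηC, hηδ⟩ : ∃ η, η ≤ η₀ / 2 ∧ 0 < η ∧ η ≤ ε / 2 / (|C| + 1) ∧
      ‖β η - a‖ < δ := by
    have h1 : ∀ᶠ η in 𝓝[>] (0:ℝ), ‖β η - a‖ < δ := by
      have := (hβ 0 ⟨by linarith, hη₀⟩).continuousAt.tendsto
      rw [hβ0] at this
      have := (this.eventually (ball_mem_nhds a hδ)).filter_mono (nhdsWithin_le_nhds (s := Ioi 0))
      simpa [dist_eq_norm] using this
    have h2 : ∀ᶠ η in 𝓝[>] (0:ℝ), η ≤ η₀ / 2 :=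
      (eventually_le_nhds (by positivity)).filter_mono nhdsWithin_le_nhds
    have h3 : ∀ᶠ η in 𝓝[>] (0:ℝ), η ≤ ε / 2 / (|C| + 1) :=
      (eventually_le_nhds (by positivity)).filter_mono nhdsWithin_le_nhds
    obtain ⟨η, h1, h2, h3, h4⟩ := (h1.and (h2.and (h3.and self_mem_nhdsWithin))).exists
    exact ⟨η, h2, h4, h3, h1⟩
  rw [le_div_iff₀ hC1] at hηC
  have T1 := htraj η ⟨hη0.le, hη⟩
  obtain ⟨L, y, u, T2, hy0, hyL, hcost⟩ := hsteer _ hηδ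
  have hL := T2.nonneg
  have T := T1.cat hgc hΩ T2 hy0.symm
  have hc0 : cat η β y 0 = a := by rw [cat_of_le _ _ hη0.le, hβ0]
  have hcL : cat η β y (η + L) = a := by rw [cat_add hy0.symm hL, hyL]
  have hη' : η ∈ Icc 0 η := ⟨hη0.le, le_rfl⟩
  have h0' : (0:ℝ) ∈ Icc 0 η := ⟨le_rfl, hη0.le⟩
  have hcost1 : ∀ s ∈ Icc 0 η, |∫ t in (0:ℝ)..s, w (β t) v1| ≤ ε / 2 := by
    intro s hs
    have h1 : ‖∫ t in (0:ℝ)..s, w (β t) v1‖ ≤ C * |s - 0| := by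
      refine intervalIntegral.norm_integral_le_of_norm_le_const fun t ht => ?_
      rw [uIoc_of_le hs.1] at ht
      exact hC t ⟨ht.1.le, ht.2.trans (hs.2.trans hη)⟩
    rw [sub_zero, abs_of_nonneg hs.1, Real.norm_eq_abs] at h1
    nlinarith [le_abs_self C, hs.1, hs.2, abs_nonneg C]
  refine ⟨η + L, _, _, T, hc0, hcL, ?_, fun s hs => ?_⟩
  · refine lt_of_lt_of_le ?_ (hpos _ _ _ (by linarith) T hc0 hcL)
    have hac := continuous_classK hα a v
    rw [cat_comp fun y u => α ‖(y - a, u - v)‖, integral_cat_add hη0.le hL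
      (T1.intervalIntegrable hΩ hac h0' hη')
      (T2.intervalIntegrable hΩ hac ⟨le_rfl, hL⟩ ⟨hL, le_rfl⟩)]
    have hαv : 0 < α ‖v1 - v‖ := by
      rw [← hα.2.2.1]
      exact hα.2.1 self_mem_Ici (norm_nonneg _) (norm_pos_iff.2 (sub_ne_zero.2 hne))
    have h1 : η * α ‖v1 - v‖ ≤ ∫ t in (0:ℝ)..η, α ‖(β t - a, v1 - v)‖ := by
      have : ∫ t in (0:ℝ)..η, α ‖v1 - v‖ = η * α ‖v1 - v‖ := by simp
      rw [← this]
      refine intervalIntegral.integral_mono_on hη0.le (by simp)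
        (T1.intervalIntegrable hΩ hac h0' hη') fun t _ => ?_
      exact hα.2.1.monotoneOn (norm_nonneg _) (norm_nonneg _) (norm_snd_le (β t - a, v1 - v))
    have h2 : 0 ≤ ∫ t in (0:ℝ)..L, α ‖(y t - a, u t - v)‖ :=
      intervalIntegral.integral_nonneg hL fun t _ => hα.2.2.2 _ (norm_nonneg _)
    have := mul_pos hη0 hαv
    linarith
  · rw [cat_comp w]
    rcases le_total s η with hsη | hsη
    · rw [integral_cat_of_le _ _ hs.1 hsη]
      linarith [hcost1 s ⟨hs.1, hsη⟩]
    · obtain ⟨s, rfl⟩ : ∃ s', s = η + s' := ⟨s - η, by ring⟩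
      have hs' : s ∈ Icc 0 L := ⟨by linarith, by linarith [hs.2]⟩
      rw [integral_cat_add hη0.le hs'.1 (T1.intervalIntegrable hΩ hw h0' hη')
        (T2.intervalIntegrable hΩ hw ⟨le_rfl, hL⟩ hs')]
      linarith [abs_add_le (∫ t in (0:ℝ)..η, w (β t) v1) (∫ t in (0:ℝ)..s, w (y t) (u t)),
        hcost1 η hη', hcost s hs']

/-- A trajectory from `a` to `a`. -/
structure Loop (g : Euc n → Euc p → Euc n) (Ω : Set (Euc p)) (a : Euc n) where
  L : ℝ
  y : ℝ → Euc n
  u : ℝ → Euc p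
  traj : IsTraj g Ω L y u
  init : y 0 = a
  final : y L = a

namespace Loop

variable {g : Euc n → Euc p → Euc n} {Ω : Set (Euc p)} {a : Euc n}

/-- The cost of a loop up to time `t`. -/
def cost (w : Euc n → Euc p → ℝ) (l : Loop g Ω a) (t : ℝ) : ℝ :=
  ∫ s in (0:ℝ)..t, w (l.y s) (l.u s)

/-- `l'` extends `l`. -/
def Extends (l l' : Loop g Ω a) : Prop :=
  l.L ≤ l'.L ∧ ∀ t ≤ l.L, l'.y t = l.y t ∧ l'.u t = l.u t

lemma Extends.trans {l l' l'' : Loop g Ω a} (h : l.Extends l') (h' : l'.Extends l'') :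
    l.Extends l'' :=
  ⟨h.1.trans h'.1, fun t ht => ⟨(h'.2 t (ht.trans h.1)).1.trans (h.2 t ht).1,
    (h'.2 t (ht.trans h.1)).2.trans (h.2 t ht).2⟩⟩

lemma Extends.cost_eq {l l' : Loop g Ω a} (h : l.Extends l') (w : Euc n → Euc p → ℝ) {t : ℝ}
    (ht : t ∈ Icc 0 l.L) : l'.cost w t = l.cost w t := by
  refine intervalIntegral.integral_congr fun s hs => ?_
  rw [uIcc_of_le ht.1] at hs
  obtain ⟨h1, h2⟩ := h.2 s (hs.2.trans ht.2)
  simp only [h1, h2]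

/-- `l'` extends `l`, with partial costs in `[C, D]` after the end of `l`. -/
def ExtendsWithin (w : Euc n → Euc p → ℝ) (C D : ℝ) (l l' : Loop g Ω a) : Prop :=
  l.Extends l' ∧ ∀ t ∈ Icc l.L l'.L, l'.cost w t ∈ Icc C D

lemma ExtendsWithin.trans {w : Euc n → Euc p → ℝ} {C C' D : ℝ} {l l' l'' : Loop g Ω a}
    (h : l.ExtendsWithin w C D l') (h' : l'.ExtendsWithin w C' D l'') (hC : C ≤ C') :
    l.ExtendsWithin w C D l'' := by
  refine ⟨h.1.trans h'.1, fun t ht => ?_⟩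
  rcases le_total t l'.L with htl | htl
  · rw [h'.1.cost_eq w ⟨l.traj.nonneg.trans ht.1, htl⟩]
    exact h.2 t ⟨ht.1, htl⟩
  · have := h'.2 t ⟨htl, ht.2⟩
    exact ⟨hC.trans this.1, this.2⟩

lemma exists_append (hg : Continuous (Function.uncurry g)) (hΩ : IsCompact Ω)
    {w : Euc n → Euc p → ℝ} (hw : Continuous (Function.uncurry w)) (l m : Loop g Ω a)
    {ε R : ℝ} (hm : ∀ s ∈ Icc 0 m.L, |m.cost w s| ≤ ε) (hR : l.cost w l.L ≤ R) :
    ∃ l' : Loop g Ω a, l'.L = l.L + m.L ∧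
      l'.cost w l'.L = l.cost w l.L + m.cost w m.L ∧
      l.ExtendsWithin w (l.cost w l.L - ε) (R + ε) l' := by
  have hl0 := l.traj.nonneg
  have hm0 := m.traj.nonneg
  have hj : l.y l.L = m.y 0 := l.final.trans m.init.symm
  have hcost : ∀ s ∈ Icc 0 m.L, ∫ t in (0:ℝ)..(l.L + s), w (cat l.L l.y m.y t)
      (cat l.L l.u m.u t) = l.cost w l.L + m.cost w s := by
    intro s hs
    rw [cat_comp w, integral_cat_add hl0 hs.1
      (l.traj.intervalIntegrable hΩ hw ⟨le_rfl, hl0⟩ ⟨hl0, le_rfl⟩)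
      (m.traj.intervalIntegrable hΩ hw ⟨le_rfl, hm0⟩ hs)]
    rfl
  refine ⟨⟨l.L + m.L, cat l.L l.y m.y, cat l.L l.u m.u, l.traj.cat hg hΩ m.traj hj, ?_, ?_⟩,
    rfl, hcost m.L ⟨hm0, le_rfl⟩, ⟨?_, fun t ht => ⟨cat_of_le _ _ ht, cat_of_le _ _ ht⟩⟩,
    fun t ht => ?_⟩
  · rw [cat_of_le _ _ hl0, l.init]
  · rw [cat_add hj hm0, m.final]
  · simpa using hm0
  · obtain ⟨s, rfl⟩ : ∃ s, t = l.L + s := ⟨t - l.L, by ring⟩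
    have hs : s ∈ Icc 0 m.L := ⟨by linarith [ht.1], by linarith [ht.2]⟩
    have e : cost w (⟨l.L + m.L, cat l.L l.y m.y, cat l.L l.u m.u, l.traj.cat hg hΩ m.traj hj,
      by rw [cat_of_le _ _ hl0, l.init], by rw [cat_add hj hm0, m.final]⟩ : Loop g Ω a)
        (l.L + s) = l.cost w l.L + m.cost w s := hcost s hs
    have := abs_le.1 (hm s hs)
    rw [e]
    constructor <;> linarith

lemma exists_append_repeat (hg : Continuous (Function.uncurry g)) (hΩ : IsCompact Ω)
    {w : Euc n → Euc p → ℝ} (hw : Continuous (Function.uncurry w)) (m : Loop g Ω a)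
    {ε R : ℝ} (hm : ∀ s ∈ Icc 0 m.L, |m.cost w s| ≤ ε) (hpos : 0 ≤ m.cost w m.L) (N : ℕ)
    (l : Loop g Ω a) (hR : l.cost w l.L + N * m.cost w m.L ≤ R) :
    ∃ l' : Loop g Ω a, l'.cost w l'.L = l.cost w l.L + N * m.cost w m.L ∧
      l.ExtendsWithin w (l.cost w l.L - ε) (R + ε) l' := by
  induction N generalizing l with
  | zero =>
    have hε : 0 ≤ ε := (abs_nonneg _).trans (hm 0 ⟨le_rfl, m.traj.nonneg⟩)
    refine ⟨l, by simp, ⟨le_rfl, fun t _ => ⟨rfl, rfl⟩⟩, fun t ht => ?_⟩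
    rw [le_antisymm ht.2 ht.1]
    simp only [Nat.cast_zero, zero_mul, add_zero] at hR
    constructor <;> linarith
  | succ N ih =>
    push_cast at hR ⊢
    have hNm : 0 ≤ N * m.cost w m.L := by positivity
    obtain ⟨l₁, -, hc, he⟩ := l.exists_append hg hΩ hw m hm (R := R) (by linarith)
    obtain ⟨l₂, hc', he'⟩ := ih l₁ (by rw [hc]; linarith)
    exact ⟨l₂, by rw [hc', hc]; ring, he.trans he' (by rw [hc]; linarith)⟩

/-- A long extension whose total cost is within `ε` of a given larger value. -/
lemma exists_extendsWithin (hg : Continuous (Function.uncurry g)) (hΩ : IsCompact Ω)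
    {w : Euc n → Euc p → ℝ} (hw : Continuous (Function.uncurry w)) {v : Euc p} (hv : v ∈ Ω)
    (hgv : g a v = 0) (hwv : w a v = 0)
    {ε R : ℝ} (hloop : ∃ m : Loop g Ω a, 0 < m.cost w m.L ∧ ∀ s ∈ Icc 0 m.L, |m.cost w s| ≤ ε)
    (l : Loop g Ω a) (hR : l.cost w l.L ≤ R) :
    ∃ l' : Loop g Ω a, l.L + 1 ≤ l'.L ∧ l'.cost w l'.L ≤ R ∧ R - ε ≤ l'.cost w l'.L ∧
      l.ExtendsWithin w (l.cost w l.L - ε) (R + ε) l' := by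
  obtain ⟨m, hm0, hm⟩ := hloop
  have hε : 0 ≤ ε := (abs_nonneg _).trans (hm 0 ⟨le_rfl, m.traj.nonneg⟩)
  let d : Loop g Ω a := ⟨1, fun _ => a, fun _ => v, .const hv hgv zero_le_one, rfl, rfl⟩
  have hd : ∀ s, d.cost w s = 0 := fun s => by simp [cost, d, hwv]
  obtain ⟨l₁, hL, hc, he⟩ := l.exists_append hg hΩ hw d (fun s _ => by simpa [hd] using hε) hR
  rw [hd, add_zero] at hc
  have hN : 0 ≤ (R - l.cost w l.L) / m.cost w m.L := div_nonneg (by linarith) hm0.le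
  have h1 := Nat.floor_le hN
  have h2 := Nat.lt_floor_add_one ((R - l.cost w l.L) / m.cost w m.L)
  rw [le_div_iff₀ hm0] at h1
  rw [div_lt_iff₀ hm0] at h2
  have h3 := (le_abs_self _).trans (hm m.L ⟨m.traj.nonneg, le_rfl⟩)
  obtain ⟨l₂, hc', he'⟩ := exists_append_repeat hg hΩ hw m hm hm0.le _ l₁ (R := R)
    (by rw [hc]; linarith)
  refine ⟨l₂, ?_, ?_, ?_, he.trans he' (by rw [hc])⟩
  · have := he'.1.1
    rw [hL] at this
    exact this
  · rw [hc', hc]; linarith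
  · rw [hc', hc]; linarith

end Loop

/-- If there are loops at a zero-cost equilibrium of arbitrarily small positive cost, then every
positive cost is attained by a trajectory on `[0,∞)` starting from the equilibrium. -/
lemma exists_isTraj_tendsto {g : Euc n → Euc p → Euc n} (hg : Continuous (Function.uncurry g))
    {Ω : Set (Euc p)} (hΩ : IsCompact Ω) {w : Euc n → Euc p → ℝ}
    (hw : Continuous (Function.uncurry w)) {a : Euc n} {v : Euc p} (hv : v ∈ Ω)
    (hgv : g a v = 0) (hwv : w a v = 0)
    (hloop : ∀ ε > 0, ∃ m : Loop g Ω a, 0 < m.cost w m.L ∧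
      ∀ s ∈ Icc 0 m.L, |m.cost w s| ≤ ε) {R : ℝ} (hR : 0 < R) :
    ∃ y u, (∀ T, 0 ≤ T → IsTraj g Ω T y u) ∧ y 0 = a ∧
      Tendsto (fun T => ∫ t in (0:ℝ)..T, w (y t) (u t)) atTop (𝓝 R) := by
  let A := {l : Loop g Ω a // l.cost w l.L ≤ R}
  let ε : ℕ → ℝ := fun k => 1 / (k + 1)
  have hε : ∀ k, 0 < ε k := fun k => Nat.one_div_pos_of_nat
  have hstep : ∀ (k : ℕ) (l : A), ∃ l' : A, l.1.L + 1 ≤ l'.1.L ∧ R - ε k ≤ l'.1.cost w l'.1.L ∧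
      l.1.ExtendsWithin w (l.1.cost w l.1.L - ε k) (R + ε k) l'.1 := by
    intro k l
    obtain ⟨l', h1, h2, h3, h4⟩ :=
      Loop.exists_extendsWithin hg hΩ hw hv hgv hwv (hloop (ε k) (hε k)) l.1 l.2
    exact ⟨⟨l', h2⟩, h1, h3, h4⟩
  choose nxt hnxt using hstep
  let l₀ : A := ⟨⟨0, fun _ => a, fun _ => v, .const hv hgv le_rfl, rfl, rfl⟩, by
    simpa [Loop.cost] using hR.le⟩
  let l : ℕ → A := fun k => Nat.rec l₀ nxt k
  have hl : ∀ k, l (k + 1) = nxt k (l k) := fun k => rfl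
  have hlen1 : ∀ k, (l k).1.L + 1 ≤ (l (k + 1)).1.L := fun k => (hnxt k (l k)).1
  have hc : ∀ k, R - ε k ≤ (l (k + 1)).1.cost w (l (k + 1)).1.L := fun k => (hnxt k (l k)).2.1
  have hex1 : ∀ k, (l k).1.ExtendsWithin w ((l k).1.cost w (l k).1.L - ε k) (R + ε k)
    (l (k + 1)).1 := fun k => (hnxt k (l k)).2.2
  have hlen : ∀ k : ℕ, (k : ℝ) ≤ (l k).1.L := by
    intro k
    induction k with
    | zero => simpa using (l 0).1.traj.nonneg
    | succ k ih => push_cast; linarith [hlen1 k]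
  have hex : ∀ j k, j ≤ k → (l j).1.Extends (l k).1 := by
    intro j k hjk
    induction k, hjk using Nat.le_induction with
    | base => exact ⟨le_rfl, fun t _ => ⟨rfl, rfl⟩⟩
    | succ k _ ih => exact ih.trans (hex1 k).1
  have hcost : ∀ j k, j + 1 ≤ k → ∀ t ∈ Icc (l (j + 1)).1.L (l k).1.L,
      (l k).1.cost w t ∈ Icc (R - 2 * ε j) (R + ε j) := by
    intro j k hjk
    induction k, hjk using Nat.le_induction with
    | base =>
      intro t ht
      rw [le_antisymm ht.2 ht.1]
      have h1 := hc j
      have h2 := (l (j + 1)).2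
      have h3 := hε j
      constructor <;> linarith
    | succ k hk ih =>
      intro t ht
      rcases le_total t (l k).1.L with htk | htk
      · rw [(hex1 k).1.cost_eq w ⟨(l (j + 1)).1.traj.nonneg.trans ht.1, htk⟩]
        exact ih t ⟨ht.1, htk⟩
      · obtain ⟨i, rfl⟩ : ∃ i, k = i + 1 := ⟨k - 1, by omega⟩
        have h1 := (hex1 (i + 1)).2 t ⟨htk, ht.2⟩
        have h2 := hc i
        have h3 : ε i ≤ ε j := Nat.one_div_le_one_div (by omega)
        have h4 : ε (i + 1) ≤ ε j := Nat.one_div_le_one_div (by omega)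
        exact ⟨by linarith [h1.1], by linarith [h1.2]⟩
  let y : ℝ → Euc n := fun t => (l ⌈t⌉₊).1.y t
  let u : ℝ → Euc p := fun t => (l ⌈t⌉₊).1.u t
  have hu : Measurable u := by
    have h1 : Measurable fun q : ℕ × ℝ => (l q.1).1.u q.2 :=
      measurable_from_prod_countable_right fun k => (l k).1.traj.adm.1
    exact h1.comp (Nat.measurable_ceil.prodMk measurable_id)
  have hyu : ∀ (k : ℕ) (t : ℝ), t ≤ k → y t = (l k).1.y t ∧ u t = (l k).1.u t := by
    intro k t ht
    obtain ⟨h1, h2⟩ := (hex ⌈t⌉₊ k (Nat.ceil_le.2 ht)).2 t ((Nat.le_ceil t).trans (hlen _))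
    exact ⟨h1.symm, h2.symm⟩
  refine ⟨y, u, fun T hT => ?_, ?_, ?_⟩
  · obtain ⟨k, hk⟩ := exists_nat_ge T
    exact ((l k).1.traj.restrict ⟨hT, hk.trans (hlen k)⟩).congr hu
      (fun t ht => (hyu k t (ht.2.trans hk)).1) (fun t ht => (hyu k t (ht.2.trans hk)).2)
  · rw [(hyu 0 0 (by simp)).1, (l 0).1.init]
  · rw [Metric.tendsto_atTop]
    intro η hη
    obtain ⟨j, hj⟩ := exists_nat_one_div_lt (show 0 < η / 2 by positivity)
    refine ⟨(l (j + 1)).1.L, fun T hT => ?_⟩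
    have hT0 : 0 ≤ T := (l (j + 1)).1.traj.nonneg.trans hT
    obtain ⟨k, hk⟩ := exists_nat_ge (max T (j + 1 : ℕ))
    obtain ⟨hk1, hk2⟩ := max_le_iff.1 hk
    have h1 := hcost j k (by exact_mod_cast hk2) T ⟨hT, hk1.trans (hlen k)⟩
    have h2 : ∫ t in (0:ℝ)..T, w (y t) (u t) = (l k).1.cost w T := by
      refine intervalIntegral.integral_congr fun t ht => ?_
      rw [uIcc_of_le hT0] at ht
      obtain ⟨e1, e2⟩ := hyu k t (ht.2.trans hk1)
      simp only [e1, e2]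
    have h3 : ε j < η / 2 := hj
    have h4 := hε j
    rw [h2, Real.dist_eq, abs_lt]
    constructor <;> linarith [h1.1, h1.2]

/-- With a single control value, the only trajectory ending at an equilibrium is constant. -/
lemma IsTraj.eq_of_subset_singleton {g : Euc n → Euc p → Euc n}
    (hg : ContDiff ℝ 1 (Function.uncurry g)) {Ω : Set (Euc p)} {a : Euc n} {v : Euc p}
    (hΩ : ∀ v' ∈ Ω, v' = v) (hgv : g a v = 0) {L : ℝ} {y : ℝ → Euc n} {u : ℝ → Euc p}
    (h : IsTraj g Ω L y u) (hyL : y L = a) : ∀ t ∈ Icc 0 L, y t = a := by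
  have hL := h.nonneg
  have hG : ContDiff ℝ 1 fun q => g q v := hg.comp (contDiff_id.prodMk contDiff_const)
  have hz : ContinuousOn (fun t => g (y t) v) (Icc 0 L) := hG.continuous.comp_continuousOn h.cont
  set φ : ℝ → Euc n := IccExtend hL ((Icc 0 L).domRestrict fun t => g (y t) v) with hφ
  have hφc : Continuous φ := (continuousOn_iff_continuous_domRestrict.1 hz).Icc_extend'
  have hφe : ∀ t ∈ Icc 0 L, φ t = g (y t) v := fun t ht => by
    rw [hφ, IccExtend_of_mem hL _ ht, domRestrict_apply]
  set Y : ℝ → Euc n := fun t => y 0 + ∫ s in (0:ℝ)..t, φ s with hY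
  have hYd : ∀ t, HasDerivAt Y (φ t) t := fun t =>
    (intervalIntegral.integral_hasDerivAt_right (hφc.intervalIntegrable _ _)
      (hφc.stronglyMeasurableAtFilter _ _) hφc.continuousAt).const_add _
  have hYy : ∀ t ∈ Icc 0 L, Y t = y t := by
    intro t ht
    rw [h.adm.2.2 t ht]
    refine congrArg (y 0 + ·) ?_
    refine intervalIntegral.integral_congr_ae ?_
    filter_upwards [(ae_restrict_iff' measurableSet_Icc).1 h.adm.2.1] with s hs hs'
    rw [uIoc_of_le ht.1] at hs'
    have hsL : s ∈ Icc 0 L := ⟨hs'.1.le, hs'.2.trans ht.2⟩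
    rw [hφe s hsL, hΩ _ (hs hsL)]
  obtain ⟨b, hb⟩ := h.exists_bound
  have hcb : IsCompact (closedBall (0 : Euc n) (max b ‖a‖)) := isCompact_closedBall _ _
  obtain ⟨K, hK⟩ := hG.contDiffOn.exists_lipschitzOnWith one_ne_zero
    (convex_closedBall (0 : Euc n) (max b ‖a‖)) hcb
  have huniq := ODE_solution_unique_of_mem_Icc_left (v := fun _ q => g q v) (K := K)
    (s := fun _ => closedBall (0 : Euc n) (max b ‖a‖)) (f := Y) (g := fun _ => a) (a := 0) (b := L)
    (fun _ _ => hK) (fun t _ => (hYd t).continuousAt.continuousWithinAt)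
    (fun t ht => by
      have ht' : t ∈ Icc 0 L := ⟨ht.1.le, ht.2⟩
      rw [hYy t ht', ← hφe t ht']
      exact (hYd t).hasDerivWithinAt)
    (fun t ht => by
      have ht' : t ∈ Icc 0 L := ⟨ht.1.le, ht.2⟩
      rw [hYy t ht', mem_closedBall_zero_iff]
      exact (hb t ht').trans (le_max_left _ _))
    continuousOn_const
    (fun t _ => by rw [hgv]; exact hasDerivWithinAt_const _ _ _)
    (fun t _ => by rw [mem_closedBall_zero_iff]; exact le_max_right _ _)
    (by rw [hYy L ⟨hL, le_rfl⟩, hyL])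
  intro t ht
  rw [← hYy t ht, huniq ht]

/-- The infinite-horizon value is at most the cost of reaching the turnpike. When the set of costs
is unbounded below the value is `0` by convention, but then uniqueness of the optimal pair fails
if the turnpike can be reached at negative cost. -/
lemma vInf_le_of_isTraj {g : Euc n → Euc p → Euc n} (hg : ContDiff ℝ 1 (Function.uncurry g))
    {Ω : Set (Euc p)} (hΩ : IsCompact Ω) {w : Euc n → Euc p → ℝ}
    (hw : Continuous (Function.uncurry w)) {a : Euc n} {v : Euc p} (hv : v ∈ Ω)
    (hgv : g a v = 0) (hwv : w a v = 0) (hsteer : SteersNear g Ω w a)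
    {α : ℝ → ℝ} (hα : IsClassK α)
    (hpos : ∀ L y u, 0 < L → IsTraj g Ω L y u → y 0 = a → y L = a →
      ∫ t in (0:ℝ)..L, α ‖(y t - a, u t - v)‖ ≤ ∫ t in (0:ℝ)..L, w (y t) (u t))
    {x : Euc n} {yo : ℝ → Euc n} {uo : ℝ → Euc p}
    (huniq : ∀ y' u', IsAdmissibleInf g Ω y' u' → y' 0 = x →
      Tendsto (fun T => ∫ t in (0:ℝ)..T, w (y' t) (u' t)) atTop (𝓝 (vInf g Ω w x)) →
      (∀ t, 0 ≤ t → y' t = yo t) ∧ (∀ᵐ t ∂(volume.restrict (Ici (0:ℝ))), u' t = uo t))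
    {L : ℝ} {y : ℝ → Euc n} {u : ℝ → Euc p} (h : IsTraj g Ω L y u) (hy0 : y 0 = x)
    (hyL : y L = a) : vInf g Ω w x ≤ ∫ t in (0:ℝ)..L, w (y t) (u t) := by
  have hgc := hg.continuous
  by_cases hbdd : BddBelow {c | ∃ y u, IsAdmissibleInf g Ω y u ∧ y 0 = x ∧
      Tendsto (fun T => ∫ t in (0:ℝ)..T, w (y t) (u t)) atTop (𝓝 c)}
  · obtain ⟨y', u', h1, h2, h3⟩ := h.exists_extension hgc hΩ hw hv hgv hwv hyL
    exact csInf_le hbdd ⟨y', u', h1, h2.trans hy0, h3⟩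
  have hv0 : vInf g Ω w x = 0 := Real.sInf_of_not_bddBelow hbdd
  rw [hv0] at huniq ⊢
  by_contra! hneg
  by_cases hsing : ∀ v' ∈ Ω, v' = v
  · have hya := h.eq_of_subset_singleton hg hsing hgv hyL
    refine hneg.ne ?_
    have : ∫ t in (0:ℝ)..L, w (y t) (u t) = ∫ t in (0:ℝ)..L, (0:ℝ) := by
      refine intervalIntegral.integral_congr_ae ?_
      filter_upwards [(ae_restrict_iff' measurableSet_Icc).1 h.adm.2.1] with s hs hs'
      rw [uIoc_of_le h.nonneg] at hs'
      have hsL : s ∈ Icc 0 L := ⟨hs'.1.le, hs'.2⟩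
      rw [hya s hsL, hsing _ (hs hsL), hwv]
    simpa using this
  push Not at hsing
  obtain ⟨v1, hv1, hne⟩ := hsing
  set c := ∫ t in (0:ℝ)..L, w (y t) (u t) with hc
  obtain ⟨Q, q, hQ, hQ0, hQc⟩ := exists_isTraj_tendsto hgc hΩ hw hv hgv hwv (R := -c)
    (fun ε hε => by
      obtain ⟨L, y, u, h1, h2, h3, h4, h5⟩ :=
        exists_small_loop hg hΩ hw hv1 hne hsteer hα hpos hε
      exact ⟨⟨L, y, u, h1, h2, h3⟩, h4, h5⟩) (by linarith)
  set K : ℝ → ℝ := fun T => ∫ t in (0:ℝ)..T, w (Q t) (q t) with hK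
  obtain ⟨hQ', hK'⟩ := (IsTraj.const (L := 1) hv hgv zero_le_one).cat_inf hgc hΩ hw hQ hQ0.symm
  set Q' := cat 1 (fun _ => a) Q with hQ'def
  set q' := cat 1 (fun _ => v) q with hq'def
  have hQ'0 : Q' 0 = a := cat_of_le _ _ zero_le_one
  have hK'' : ∀ s, 0 ≤ s → ∫ t in (0:ℝ)..(1 + s), w (Q' t) (q' t) = K s := by
    intro s hs
    rw [hK' s hs]
    simp [hwv, hK]
  have hQ'c : Tendsto (fun T => ∫ t in (0:ℝ)..T, w (Q' t) (q' t)) atTop (𝓝 (0 + -c)) :=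
    tendsto_of_shift (fun s hs => by rw [hK'' s hs, zero_add]) hQc
  rw [zero_add] at hQ'c
  obtain ⟨hP, hPc⟩ := h.cat_inf hgc hΩ hw hQ (hyL.trans hQ0.symm)
  obtain ⟨hP', hPc'⟩ := h.cat_inf hgc hΩ hw hQ' (hyL.trans hQ'0.symm)
  have t1 := tendsto_of_shift
    (J := fun T => ∫ t in (0:ℝ)..T, w (cat L y Q t) (cat L u q t)) hPc hQc
  have t2 := tendsto_of_shift
    (J := fun T => ∫ t in (0:ℝ)..T, w (cat L y Q' t) (cat L u q' t)) hPc' hQ'c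
  rw [← hc, add_neg_cancel] at t1 t2
  obtain ⟨e1, e1'⟩ := huniq _ _ (isAdmissibleInf_of_isTraj hP)
    ((cat_of_le _ _ h.nonneg).trans hy0) t1
  obtain ⟨e2, e2'⟩ := huniq _ _ (isAdmissibleInf_of_isTraj hP')
    ((cat_of_le _ _ h.nonneg).trans hy0) t2
  have hper : ∀ s, 0 ≤ s → K (1 + s) = K s := by
    intro s hs
    have h1 : ∫ t in (0:ℝ)..(L + (1 + s)), w (cat L y Q t) (cat L u q t) =
        ∫ t in (0:ℝ)..(L + (1 + s)), w (cat L y Q' t) (cat L u q' t) := by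
      refine intervalIntegral.integral_congr_ae ?_
      filter_upwards [(ae_restrict_iff' measurableSet_Ici).1 e1',
        (ae_restrict_iff' measurableSet_Ici).1 e2'] with t ht ht' hmem
      rw [uIoc_of_le (by linarith [h.nonneg])] at hmem
      have ht0 : (0:ℝ) ≤ t := hmem.1.le
      rw [e1 t ht0, e2 t ht0, ht ht0, ht' ht0]
    rw [hPc _ (by linarith), hPc' _ (by linarith), hK'' s hs] at h1
    exact add_left_cancel h1
  have hzero : ∀ N : ℕ, K N = 0 := by
    intro N
    induction N with
    | zero => simp [hK]
    | succ N ih => rw [Nat.cast_succ, add_comm, hper _ N.cast_nonneg, ih]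
  have h1 : Tendsto (fun N : ℕ => K N) atTop (𝓝 (-c)) := hQc.comp tendsto_natCast_atTop_atTop
  simp only [hzero] at h1
  have := tendsto_nhds_unique h1 tendsto_const_nhds
  linarith

/-- Turnpike property: a trajectory with bounded cost on a long interval passes close to the
static minimizer. -/
lemma exists_norm_sub_lt {f : Euc n → Euc p → Euc n} {Ω : Set (Euc p)}
    (hΩ : IsCompact Ω) {w : Euc n → Euc p → ℝ}
    {a : Euc n} {v : Euc p} {S : Euc n → ℝ} {α : ℝ → ℝ}
    (hdis : StrictlyDissipative f Ω w a v S α) (M : ℝ) {δ : ℝ} (hδ : 0 < δ) :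
    ∃ T₁, ∀ T ≥ T₁, ∀ y u, IsTraj f Ω T y u → (∫ t in (0:ℝ)..T, w (y t) (u t)) ≤ M →
      ∃ t ∈ Icc 0 T, ‖y t - a‖ < δ := by
  obtain ⟨⟨B, hB⟩, hα, hd⟩ := hdis
  have hαδ : 0 < α δ := by
    rw [← hα.2.2.1]
    exact hα.2.1 self_mem_Ici hδ.le hδ
  refine ⟨max 1 ((2 * B + M + 1) / α δ), fun T hT y u h hM => ?_⟩
  obtain ⟨hT1, hT2⟩ := max_le_iff.1 hT
  by_contra! hfar
  have hT0 : 0 ≤ T := by linarith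
  have h1 : T * α δ ≤ ∫ t in (0:ℝ)..T, α ‖(y t - a, u t - v)‖ := by
    have : ∫ t in (0:ℝ)..T, α δ = T * α δ := by simp
    rw [← this]
    refine intervalIntegral.integral_mono_on hT0 (by simp)
      (h.intervalIntegrable hΩ (continuous_classK hα a v) ⟨le_rfl, hT0⟩ ⟨hT0, le_rfl⟩)
      fun t ht => ?_
    exact hα.2.1.monotoneOn hδ.le (norm_nonneg _)
      ((hfar t ht).trans (norm_fst_le (y t - a, u t - v)))
  have h2 := hd T (by linarith) y u h.adm
  have h3 := abs_le.1 (hB (y 0))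
  have h4 := abs_le.1 (hB (y T))
  rw [div_le_iff₀ hαδ] at hT2
  linarith

/-- Step 1 (lower estimate): `v_f(x) + v_b(z) ≤ liminf_{T→∞} C_T(û_T,x,z)`,
where `C_T(û_T,x,z) = ∫₀ᵀ w(ŷ_T,û_T)` is the shifted optimal cost. -/
theorem shifted_cost_lower_estimate
    {n pp : ℕ} (c : ℝ)
    (f : Euc n → Euc pp → Euc n) (f0 : Euc n → Euc pp → ℝ)
    (Ω : Set (Euc pp))
    -- (A1) regularity of the data
    (hf : ContDiff ℝ 1 (Function.uncurry f))
    (hf0 : ContDiff ℝ 1 (Function.uncurry f0))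
    (hΩcpt : IsCompact Ω) (hΩball : Ω ⊆ closedBall 0 c)
    -- static problem and its unique minimizer
    (ybar : Euc n) (ubar : Euc pp) (vbar : ℝ)
    (hfbar : f ybar ubar = 0) (hvbar : f0 ybar ubar = vbar)
    (hstatmin : ∀ y u, f y u = 0 → vbar ≤ f0 y u)
    (hstatuniq : ∀ y u, f y u = 0 → f0 y u = vbar → y = ybar ∧ u = ubar)
    -- shifted cost
    (w : Euc n → Euc pp → ℝ) (hwdef : w = fun y u => f0 y u - f0 ybar ubar)
    (x z : Euc n)
    -- (A2): existence and uniqueness of optimal solutions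
    (T0 : ℝ) (hT0 : 0 < T0)
    (yT : ℝ → ℝ → Euc n) (uT : ℝ → ℝ → Euc pp)
    (yf : ℝ → Euc n) (uf : ℝ → Euc pp) (yb : ℝ → Euc n) (ub : ℝ → Euc pp)
    (hoptT : ∀ T, T0 ≤ T → IsAdmissible f Ω T (yT T) (uT T) ∧ yT T 0 = x ∧ yT T T = z ∧
      (∫ t in (0:ℝ)..T, f0 (yT T t) (uT T t)) = valueFn f f0 Ω T x z)
    (huniqT : ∀ T, T0 ≤ T → ∀ y' u', IsAdmissible f Ω T y' u' → y' 0 = x → y' T = z →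
      (∫ t in (0:ℝ)..T, f0 (y' t) (u' t)) = valueFn f f0 Ω T x z →
      (∀ t ∈ Icc (0:ℝ) T, y' t = yT T t) ∧
      (∀ᵐ t ∂(volume.restrict (Icc (0:ℝ) T)), u' t = uT T t))
    (hoptf : IsAdmissibleInf f Ω yf uf ∧ yf 0 = x ∧
      Tendsto (fun T => ∫ t in (0:ℝ)..T, w (yf t) (uf t)) atTop (𝓝 (vInf f Ω w x)))
    (huniqf : ∀ y' u', IsAdmissibleInf f Ω y' u' → y' 0 = x →
      Tendsto (fun T => ∫ t in (0:ℝ)..T, w (y' t) (u' t)) atTop (𝓝 (vInf f Ω w x)) →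
      (∀ t, 0 ≤ t → y' t = yf t) ∧ (∀ᵐ t ∂(volume.restrict (Ici (0:ℝ))), u' t = uf t))
    (hoptb : IsAdmissibleInf (fun a b => -f a b) Ω yb ub ∧ yb 0 = z ∧
      Tendsto (fun T => ∫ t in (0:ℝ)..T, w (yb t) (ub t)) atTop
        (𝓝 (vInf (fun a b => -f a b) Ω w z)))
    (huniqb : ∀ y' u', IsAdmissibleInf (fun a b => -f a b) Ω y' u' → y' 0 = z →
      Tendsto (fun T => ∫ t in (0:ℝ)..T, w (y' t) (u' t)) atTop
        (𝓝 (vInf (fun a b => -f a b) Ω w z)) →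
      (∀ t, 0 ≤ t → y' t = yb t) ∧ (∀ᵐ t ∂(volume.restrict (Ici (0:ℝ))), u' t = ub t))
    -- (A3): uniform boundedness of the optimal trajectories
    (b : ℝ)
    (hbndT : ∀ T, T0 ≤ T → ∀ t ∈ Icc (0:ℝ) T, ‖yT T t‖ ≤ b)
    (hbndf : ∀ t, 0 ≤ t → ‖yf t‖ ≤ b)
    (hbndb : ∀ t, 0 ≤ t → ‖yb t‖ ≤ b)
    -- (A4): uniform boundedness of the optimal (shifted) costs
    (M : ℝ)
    (hcstT : ∀ T, T0 ≤ T → |∫ t in (0:ℝ)..T, w (yT T t) (uT T t)| ≤ M)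
    (hcstf : ∀ T, 0 ≤ T → |∫ t in (0:ℝ)..T, w (yf t) (uf t)| ≤ M)
    (hcstb : ∀ T, 0 ≤ T → |∫ t in (0:ℝ)..T, w (yb t) (ub t)| ≤ M)
    -- (A5): the static control is interior
    (hubar : ubar ∈ interior Ω)
    -- (A6): strict dissipativity
    (S : Euc n → ℝ) (α : ℝ → ℝ)
    (hdis : StrictlyDissipative f Ω w ybar ubar S α)
    -- (A7): minimum time functions are finite (and attained) near ȳ, vanish and are continuous at ȳ
    (r : ℝ) (hr : 0 < r)
    (hreachf : ∀ x' ∈ ball ybar r, minTime f Ω x' ybar ∈ reachTimes f Ω x' ybar)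
    (hreachb : ∀ x' ∈ ball ybar r,
      minTime (fun a b => -f a b) Ω x' ybar ∈ reachTimes (fun a b => -f a b) Ω x' ybar)
    (hτf0 : minTime f Ω ybar ybar = 0)
    (hτb0 : minTime (fun a b => -f a b) Ω ybar ybar = 0)
    (hτfcont : ContinuousWithinAt (fun x' => minTime f Ω x' ybar) (ball ybar r) ybar)
    (hτbcont : ContinuousWithinAt (fun x' => minTime (fun a b => -f a b) Ω x' ybar)
      (ball ybar r) ybar)
    -- (A8): local boundedness of the minimum time trajectories and controls near the turnpike
    (r2 Kr : ℝ) (hr2 : 0 < r2) (hKr : 0 < Kr)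
    (hA8f : ∀ x' ∈ closedBall ybar r2, ∃ y' u',
      IsAdmissible f Ω (minTime f Ω x' ybar) y' u' ∧ y' 0 = x' ∧
      y' (minTime f Ω x' ybar) = ybar ∧
      ∀ t ∈ Icc (0:ℝ) (minTime f Ω x' ybar), ‖y' t - ybar‖ + ‖u' t - ubar‖ ≤ Kr)
    (hA8b : ∀ x' ∈ closedBall ybar r2, ∃ y' u',
      IsAdmissible (fun a b => -f a b) Ω (minTime (fun a b => -f a b) Ω x' ybar) y' u' ∧
      y' 0 = x' ∧ y' (minTime (fun a b => -f a b) Ω x' ybar) = ybar ∧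
      ∀ t ∈ Icc (0:ℝ) (minTime (fun a b => -f a b) Ω x' ybar),
        ‖y' t - ybar‖ + ‖u' t - ubar‖ ≤ Kr)
    :
    vInf f Ω w x + vInf (fun a b => -f a b) Ω w z ≤
      atTop.liminf (fun T => ∫ t in (0:ℝ)..T, w (yT T t) (uT T t)) := by
  have hubΩ : ubar ∈ Ω := interior_subset hubar
  have hfc := hf.continuous
  have hw : Continuous (Function.uncurry w) := by
    rw [hwdef]
    exact hf0.continuous.sub continuous_const
  have hwbar : w ybar ubar = 0 := by simp [hwdef]
  have hfneg : ContDiff ℝ 1 (Function.uncurry fun a b => -f a b) := hf.neg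
  have hsf := steersNear_of_minTime hfc hΩcpt hw hr hr2 hτf0 hτfcont hA8f
  have hsb := steersNear_of_minTime hfneg.continuous hΩcpt hw hr hr2 hτb0 hτbcont hA8b
  have hposf : ∀ L y u, 0 < L → IsTraj f Ω L y u → y 0 = ybar → y L = ybar →
      ∫ t in (0:ℝ)..L, α ‖(y t - ybar, u t - ubar)‖ ≤ ∫ t in (0:ℝ)..L, w (y t) (u t) := by
    intro L y u hL h h0 h1
    have := hdis.2.2 L hL y u h.adm
    rw [h0, h1] at this
    linarith
  have hposb : ∀ L y u, 0 < L → IsTraj (fun a b => -f a b) Ω L y u → y 0 = ybar → y L = ybar →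
      ∫ t in (0:ℝ)..L, α ‖(y t - ybar, u t - ubar)‖ ≤ ∫ t in (0:ℝ)..L, w (y t) (u t) := by
    intro L y u hL h h0 h1
    have := hposf L _ _ hL
      (h.reverse (g' := f) hfneg.continuous (fun a b => (neg_neg _).symm) hΩcpt)
      (by simpa using h1) (by simpa using h0)
    rw [intervalIntegral.integral_comp_sub_left (fun t => w (y t) (u t)) L,
      intervalIntegral.integral_comp_sub_left
        (fun t => α ‖(y t - ybar, u t - ubar)‖) L] at this
    simpa using this
  have hcob : IsCoboundedUnder (· ≥ ·) atTop
      (fun T => ∫ t in (0:ℝ)..T, w (yT T t) (uT T t)) := by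
    refine IsBoundedUnder.isCoboundedUnder_ge (isBoundedUnder_of_eventually_le (a := M) ?_)
    filter_upwards [eventually_ge_atTop T0] with T hT using (abs_le.1 (hcstT T hT)).2
  refine le_of_forall_pos_le_add fun ε hε => ?_
  rw [← sub_le_iff_le_add]
  refine le_liminf_of_le hcob ?_
  obtain ⟨δf, hδf, hsf'⟩ := hsf (ε / 2) (by positivity)
  obtain ⟨δb, hδb, hsb'⟩ := hsb (ε / 2) (by positivity)
  obtain ⟨T1, hT1⟩ := exists_norm_sub_lt hΩcpt hdis M (lt_min hδf hδb)
  filter_upwards [eventually_ge_atTop T0, eventually_ge_atTop T1] with T hT hT'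
  obtain ⟨hadm, hx, hz, -⟩ := hoptT T hT
  have hT0' : 0 ≤ T := hT0.le.trans hT
  have htr := hadm.isTraj hfc hΩcpt hT0' (hbndT T hT)
  obtain ⟨t, ht, hnear⟩ := hT1 T hT' _ _ htr (abs_le.1 (hcstT T hT)).2
  rw [lt_min_iff] at hnear
  have htT : T - t ∈ Icc 0 T := ⟨by linarith [ht.2], by linarith [ht.1]⟩
  obtain ⟨Lf, yf', uf', hf1, hf2, hf3, hf4⟩ := hsf' _ hnear.1
  obtain ⟨Lb, yb', ub', hb1, hb2, hb3, hb4⟩ := hsb' _ hnear.2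
  have htf := htr.restrict ht
  have htb := (htr.reverse (g' := fun a b => -f a b) hfc (fun _ _ => rfl) hΩcpt).restrict htT
  have hjb : (fun s => yT T (T - s)) (T - t) = yb' 0 := by simp [hb2]
  have hF := vInf_le_of_isTraj hf hΩcpt hw hubΩ hfbar hwbar hsf hdis.2.1 hposf huniqf
    (htf.cat hfc hΩcpt hf1 hf2.symm) ((cat_of_le _ _ ht.1).trans hx)
    ((cat_add hf2.symm hf1.nonneg).trans hf3)
  have hB := vInf_le_of_isTraj hfneg hΩcpt hw hubΩ (by simp [hfbar]) hwbar hsb hdis.2.1 hposb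
    huniqb (htb.cat hfneg.continuous hΩcpt hb1 hjb)
    ((cat_of_le _ _ htT.1).trans (by simpa using hz))
    ((cat_add (L := T - t) (φ := fun s => yT T (T - s)) hjb hb1.nonneg).trans hb3)
  rw [cat_comp w, integral_cat_add ht.1 hf1.nonneg
    (htf.intervalIntegrable hΩcpt hw ⟨le_rfl, ht.1⟩ ⟨ht.1, le_rfl⟩)
    (hf1.intervalIntegrable hΩcpt hw ⟨le_rfl, hf1.nonneg⟩ ⟨hf1.nonneg, le_rfl⟩)] at hF
  rw [cat_comp w, integral_cat_add htT.1 hb1.nonneg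
    (htb.intervalIntegrable hΩcpt hw ⟨le_rfl, htT.1⟩ ⟨htT.1, le_rfl⟩)
    (hb1.intervalIntegrable hΩcpt hw ⟨le_rfl, hb1.nonneg⟩ ⟨hb1.nonneg, le_rfl⟩),
    intervalIntegral.integral_comp_sub_left (fun s => w (yT T s) (uT T s)) T,
    sub_sub_cancel, sub_zero] at hB
  have hsum := intervalIntegral.integral_add_adjacent_intervals
    (htr.intervalIntegrable hΩcpt hw ⟨le_rfl, hT0'⟩ ht)
    (htr.intervalIntegrable hΩcpt hw ht ⟨hT0', le_rfl⟩)
  have h1 := (abs_le.1 (hf4 Lf ⟨hf1.nonneg, le_rfl⟩)).2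
  have h2 := (abs_le.1 (hb4 Lb ⟨hb1.nonneg, le_rfl⟩)).2
  linarith
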